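/- Let t : {0,1}* × {0,1}* → {0,1}* be a computable function with the rectangle property. Then there exists a constant d (depending only on t and the universal machine) such that for every n ≥ 2 and all binary strings x, y of length n, I(x : y : t(x,y)) ≥ −d·log₂ n − d. -/

import Mathlib

/-- A machine maps a program and a condition string to at most one output string. -/
abbrev Machine := List Bool → List Bool →. List Bool

/-- Conditional Kolmogorov complexity relative to machine `U`. -/
noncomputable def KC (U : Machine) (x u : List Bool) : ℕ :=
  sInf { k | ∃ p : List Bool, p.length = k ∧ x ∈ U p u }

/-- `U` is a universal machine. -/
def IsUniversal (U : Machine) : Prop :=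
  Partrec₂ U ∧
    ∀ V : Machine, Partrec₂ V →
      ∃ c : ℕ, ∀ p u x, x ∈ V p u → ∃ q : List Bool, x ∈ U q u ∧ q.length ≤ p.length + c

/-- Self-delimiting encoding of a string. -/
def eBits (x : List Bool) : List Bool := (x.map fun b => [b, b]).flatten ++ [true, false]

/-- The fixed computable pairing of strings. -/
def ePair (x y : List Bool) : List Bool := eBits x ++ y

/-- Encoding of a list of strings. -/
def eList (l : List (List Bool)) : List Bool := (l.map eBits).flatten

/-- Conditional mutual information `I(x : y ∣ u)`. -/
noncomputable def MI (U : Machine) (x y u : List Bool) : ℝ :=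
  (KC U x u : ℝ) + KC U y u - KC U (ePair x y) u

/-- Conditional triple information `I(x : y : w ∣ u)`. -/
noncomputable def TI (U : Machine) (x y w u : List Bool) : ℝ :=
  (KC U x u : ℝ) + KC U y u + KC U w u - KC U (ePair x y) u - KC U (ePair x w) u
    - KC U (ePair y w) u + KC U (ePair x (ePair y w)) u

/-- A combinatorial rectangle, given by its list of rows and list of columns. -/
structure Rect where
  rows : List (List Bool)
  cols : List (List Bool)
deriving DecidableEq

/-- Canonical encoding of a rectangle. -/
def encRect (R : Rect) : List Bool := ePair (eList R.rows) (eList R.cols)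

/-- The list of all bit strings of length `n`. -/
def allBV : ℕ → List (List Bool)
  | 0 => [[]]
  | n + 1 => (allBV n).flatMap fun x => [false :: x, true :: x]

/-- A nondeterministic communication protocol over `{0,1}^{n₁} × {0,1}^{n₂}`:
a finite family of rectangles covering the domain together with a transcript
function selecting, for every cell of the domain, a rectangle containing it. -/
structure Protocol (n₁ n₂ : ℕ) where
  rects : List Rect
  trans : List Bool → List Bool → Rect
  rows_len : ∀ R ∈ rects, ∀ s ∈ R.rows, s.length = n₁
  cols_len : ∀ R ∈ rects, ∀ s ∈ R.cols, s.length = n₂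
  trans_mem : ∀ x y : List Bool, x.length = n₁ → y.length = n₂ → trans x y ∈ rects
  trans_row : ∀ x y : List Bool, x.length = n₁ → y.length = n₂ → x ∈ (trans x y).rows
  trans_col : ∀ x y : List Bool, x.length = n₁ → y.length = n₂ → y ∈ (trans x y).cols

/-- The thickness of a cell: the number of rectangles of the protocol containing it. -/
def cellThick {n₁ n₂ : ℕ} (P : Protocol n₁ n₂) (x y : List Bool) : ℕ :=
  P.rects.countP fun R => decide (x ∈ R.rows ∧ y ∈ R.cols)

/-- The thickness of a rectangle: the maximal thickness of a cell of the rectangle. -/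
def rectThick {n₁ n₂ : ℕ} (P : Protocol n₁ n₂) (R : Rect) : ℕ :=
  (R.rows.flatMap fun x => R.cols.map fun y => cellThick P x y).foldr max 0

/-- Canonical encoding of a protocol: the list of its rectangles followed by
the graph of the transcript function on the domain. -/
def encProt {n₁ n₂ : ℕ} (P : Protocol n₁ n₂) : List Bool :=
  ePair (eList (P.rects.map encRect))
    (eList ((allBV n₁).flatMap fun x => (allBV n₂).map fun y => encRect (P.trans x y)))

/-- `t` has the rectangle property. -/
def RectProperty (t : List Bool → List Bool → List Bool) : Prop :=
  ∀ x₁ y₁ x₂ y₂ : List Bool,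
    t x₁ y₁ = t x₂ y₂ → t x₁ y₂ = t x₁ y₁ ∧ t x₂ y₁ = t x₁ y₁

/-! ### Encodings -/

theorem eBits_cons (b : Bool) (x : List Bool) : eBits (b :: x) = b :: b :: eBits x := by
  simp [eBits]

theorem ePair_length (x y : List Bool) : (ePair x y).length = 2 * x.length + 2 + y.length := by
  induction x with
  | nil => simp [ePair, eBits]; omega
  | cons b x ih =>
    simp only [ePair, eBits_cons, List.cons_append, List.length_cons] at ih ⊢
    omega

theorem ePair_inj {x y x' y' : List Bool} (h : ePair x y = ePair x' y') : x = x' ∧ y = y' := by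
  induction x generalizing x' with
  | nil =>
    cases x' with
    | nil => simpa [ePair, eBits] using h
    | cons b x' =>
      simp only [ePair, eBits_cons] at h
      cases b <;> simp [eBits] at h
  | cons b x ih =>
    cases x' with
    | nil =>
      simp only [ePair, eBits_cons] at h
      cases b <;> simp [eBits] at h
    | cons b' x' =>
      simp only [ePair, eBits_cons, List.cons_append, List.cons.injEq] at h
      obtain ⟨rfl, rfl⟩ := ih h.2.2
      exact ⟨by rw [h.1], rfl⟩

theorem computable₂_ePair : Computable₂ ePair := by
  apply Primrec₂.to_comp
  refine Primrec.list_append.comp (Primrec.list_append.comp ?_ (Primrec.const _)) Primrec.snd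
  refine Primrec.list_flatten.comp (Primrec.list_map Primrec.fst ?_)
  exact Primrec.list_cons.comp Primrec.snd (Primrec.list_cons.comp Primrec.snd (Primrec.const []))

theorem computable_ePair {α : Type} [Primcodable α] {f g : α → List Bool} (hf : Computable f)
    (hg : Computable g) : Computable fun a => ePair (f a) (g a) :=
  computable₂_ePair.comp hf hg

/-- The number with a given list of binary digits, least significant digit first. -/
def bitsVal (l : List Bool) : ℕ := l.foldr (fun b n => bif b then n + n + 1 else n + n) 0

theorem bitsVal_bits (n : ℕ) : bitsVal n.bits = n := by
  induction n using Nat.binaryRec' with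
  | zero => simp [bitsVal]
  | bit b n hb ih =>
    rw [Nat.bits_append_bit _ _ hb]
    simp only [bitsVal, List.foldr_cons] at ih ⊢
    rw [ih]
    cases b <;> simp [Nat.bit] <;> omega

theorem computable_bitsVal : Computable bitsVal := by
  apply Primrec.to_comp
  have h : Primrec fun z : List Bool × Bool × ℕ => z.2.2 + z.2.2 :=
    Primrec.nat_add.comp (Primrec.snd.comp Primrec.snd) (Primrec.snd.comp Primrec.snd)
  have hstep : Primrec₂ fun (_ : List Bool) (z : Bool × ℕ) =>
      bif z.1 then z.2 + z.2 + 1 else z.2 + z.2 :=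
    Primrec.cond (Primrec.fst.comp Primrec.snd) (Primrec.succ.comp h) h
  exact Primrec.list_foldr (f := fun l : List Bool => l) Primrec.id (Primrec.const 0) hstep

/-! ### Upper bounds on Kolmogorov complexity -/

section Complexity

variable {U : Machine}

theorem KC_le {x u p : List Bool} (h : x ∈ U p u) : KC U x u ≤ p.length :=
  Nat.sInf_le ⟨p, rfl, h⟩

theorem computable_decide_eq {α β : Type} [Primcodable α] [Primcodable β] [DecidableEq β]
    {f g : α → β} (hf : Computable f) (hg : Computable g) :
    Computable fun a => decide (f a = g a) :=
  Primrec.eq.decide.to_comp.comp hf hg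

theorem computable_decide_le_length {α : Type} [Primcodable α] {f : α → ℕ}
    {g : α → List (List Bool)} (hf : Computable f) (hg : Computable g) :
    Computable fun a => decide (f a ≤ (g a).length) :=
  Primrec.nat_le.decide.to_comp.comp hf (Computable.list_length.comp hg)

theorem exists_partrec_leftInverse {α : Type} [Primcodable α] {f : α → List Bool}
    (hf : Computable f) (hinj : Function.Injective f) :
    ∃ i : List Bool →. α, Partrec i ∧ ∀ a, a ∈ i (f a) := by
  refine ⟨fun p => Nat.rfindOpt fun k =>
    (Encodable.decode k : Option α).bind fun a =>
      bif decide (f a = p) then some a else none, ?_, ?_⟩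
  · refine Partrec.rfindOpt ?_
    refine Computable.option_bind (Computable.decode.comp Computable.snd) ?_
    have hp : Computable fun z : (List Bool × ℕ) × α => z.1.1 :=
      Computable.fst.comp Computable.fst
    exact Computable.cond (computable_decide_eq (hf.comp Computable.snd) hp)
      (Computable.option_some.comp Computable.snd) (Computable.const none)
  · intro a
    have hsome : ∀ k b, ((Encodable.decode k : Option α).bind fun b =>
        bif decide (f b = f a) then some b else none) = some b → b = a := by
      intro k b h
      obtain ⟨b', -, h⟩ := Option.bind_eq_some_iff.1 h
      by_cases hb : f b' = f a
      · simp only [hb, decide_true, cond_true, Option.some.injEq] at h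
        exact h ▸ hinj hb
      · simp [hb] at h
    have hdom := (Nat.rfindOpt_dom (f := fun k => (Encodable.decode k : Option α).bind fun b =>
        bif decide (f b = f a) then some b else none)).2 ⟨Encodable.encode a, a, by simp⟩
    obtain ⟨b, hb⟩ := Part.dom_iff_mem.1 hdom
    obtain ⟨k, hk⟩ := Nat.rfindOpt_spec hb
    exact hsome k b hk ▸ hb

theorem IsUniversal.exists_KC_le (hU : IsUniversal U) {α : Type} [Primcodable α]
    {f : α → List Bool} (hf : Computable f) (hinj : Function.Injective f)
    {g : α →. List Bool} (hg : Partrec g) :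
    ∃ c, ∀ a x, x ∈ g a → KC U x [] ≤ (f a).length + c := by
  obtain ⟨i, hi, hia⟩ := exists_partrec_leftInverse hf hinj
  obtain ⟨c, hc⟩ := hU.2 (fun p _ => (i p).bind g)
    ((hi.comp Computable.fst).bind (hg.comp Computable.snd).to₂)
  refine ⟨c, fun a x hx => ?_⟩
  obtain ⟨q, hq, hl⟩ := hc (f a) [] x (Part.mem_bind (hia a) hx)
  exact (KC_le hq).trans hl

theorem IsUniversal.exists_program (hU : IsUniversal U) (x : List Bool) :
    ∃ p : List Bool, p.length = KC U x [] ∧ x ∈ U p [] := by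
  obtain ⟨c, hc⟩ := hU.2 (fun p _ => Part.some p) Computable.fst
  obtain ⟨q, hq, -⟩ := hc x [] x (Part.mem_some x)
  exact Nat.sInf_mem (s := {k | ∃ p : List Bool, p.length = k ∧ x ∈ U p []}) ⟨_, q, rfl, hq⟩

theorem IsUniversal.partrec_nil (hU : IsUniversal U) : Partrec fun p => U p [] :=
  Partrec₂.comp hU.1 Computable.id (Computable.const [])

/-- Applying a partial computable function increases complexity by at most a constant. -/
theorem IsUniversal.exists_KC_map_le (hU : IsUniversal U) {g : List Bool →. List Bool}
    (hg : Partrec g) : ∃ c, ∀ z x, x ∈ g z → KC U x [] ≤ KC U z [] + c := by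
  obtain ⟨c, hc⟩ := hU.exists_KC_le Computable.id Function.injective_id
    (hU.partrec_nil.bind (hg.comp Computable.snd).to₂)
  refine ⟨c, fun z x hx => ?_⟩
  obtain ⟨p, hp, hz⟩ := hU.exists_program z
  exact hp ▸ hc p x (Part.mem_bind hz hx)

theorem IsUniversal.exists_KC_pair_le_triple (hU : IsUniversal U) :
    ∃ c, ∀ x y w, KC U (ePair x y) [] ≤ KC U (ePair x (ePair y w)) [] + c := by
  have hf : Computable fun a : List Bool × List Bool × List Bool => ePair a.1 (ePair a.2.1 a.2.2) :=
    computable_ePair Computable.fst (computable_ePair (Computable.fst.comp Computable.snd)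
      (Computable.snd.comp Computable.snd))
  obtain ⟨i, hi, hia⟩ := exists_partrec_leftInverse hf (by
    rintro ⟨x, y, w⟩ ⟨x', y', w'⟩ h
    obtain ⟨rfl, h⟩ := ePair_inj h
    obtain ⟨rfl, rfl⟩ := ePair_inj h
    rfl)
  have hg : Computable fun a : List Bool × List Bool × List Bool => ePair a.1 a.2.1 :=
    computable_ePair Computable.fst (Computable.fst.comp Computable.snd)
  obtain ⟨c, hc⟩ := hU.exists_KC_map_le (hi.map (hg.comp Computable.snd).to₂)
  exact ⟨c, fun x y w => hc _ _ (Part.mem_map _ (hia (x, y, w)))⟩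

end Complexity

/-! ### Enumerations -/

/-- The distinct values among the first `s` values of an enumeration, in order of appearance. -/
def enumList (e : ℕ → Option (List Bool)) : ℕ → List (List Bool)
  | 0 => []
  | s + 1 => (e s).elim (enumList e s) fun b =>
      bif decide ((enumList e s).idxOf b + 1 ≤ (enumList e s).length) then enumList e s
      else enumList e s ++ [b]

theorem enumList_succ (e : ℕ → Option (List Bool)) (s : ℕ) :
    (e s = none ∧ enumList e (s + 1) = enumList e s) ∨
    (∃ b, e s = some b ∧ b ∈ enumList e s ∧ enumList e (s + 1) = enumList e s) ∨
    ∃ b, e s = some b ∧ b ∉ enumList e s ∧ enumList e (s + 1) = enumList e s ++ [b] := by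
  rcases h : e s with _ | b
  · simp [enumList, h]
  · by_cases hb : b ∈ enumList e s <;> simp [enumList, h, List.idxOf_lt_length_iff, hb]

theorem mem_enumList {e : ℕ → Option (List Bool)} {s : ℕ} {b : List Bool} :
    b ∈ enumList e s ↔ ∃ i < s, e i = some b := by
  induction s with
  | zero => simp [enumList]
  | succ s ih =>
    simp only [Nat.lt_succ_iff_lt_or_eq, or_and_right, exists_or, ← ih, exists_eq_left]
    rcases enumList_succ e s with ⟨h, h'⟩ | ⟨c, h, hc, h'⟩ | ⟨c, h, hc, h'⟩ <;> rw [h', h]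
    · simp
    · simp only [Option.some.injEq]
      exact ⟨Or.inl, fun h => h.elim id fun h => h ▸ hc⟩
    · simp [eq_comm]

theorem nodup_enumList (e : ℕ → Option (List Bool)) (s : ℕ) : (enumList e s).Nodup := by
  induction s with
  | zero => simp [enumList]
  | succ s ih =>
    rcases enumList_succ e s with ⟨h, h'⟩ | ⟨c, h, hc, h'⟩ | ⟨c, h, hc, h'⟩ <;> rw [h']
    · exact ih
    · exact ih
    · rw [← List.concat_eq_append]
      exact ih.concat hc

theorem enumList_prefix (e : ℕ → Option (List Bool)) {s s' : ℕ} (h : s ≤ s') :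
    enumList e s <+: enumList e s' := by
  induction s', h using Nat.le_induction with
  | base => exact List.prefix_rfl
  | succ s' _ ih =>
    refine ih.trans ?_
    rcases enumList_succ e s' with ⟨h, h'⟩ | ⟨c, h, hc, h'⟩ | ⟨c, h, hc, h'⟩ <;> simp [h']

theorem computable_idxOf {α : Type} [Primcodable α] {f : α → List Bool} {g : α → List (List Bool)}
    (hf : Computable f) (hg : Computable g) : Computable fun a => (g a).idxOf (f a) := by
  have h := (Primrec.list_idxOf (α := List Bool)).to_comp.comp hf hg
  rwa [lawful_beq_subsingleton instBEqOfDecidableEq (List.instBEq : BEq (List Bool))] at h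

theorem computable_enumList {σ : Type} [Primcodable σ] {e : σ → ℕ → Option (List Bool)}
    (he : Computable₂ e) : Computable₂ fun P s => enumList (e P) s := by
  let A := (σ × ℕ) × ℕ × List (List Bool)
  have hL : Computable fun z : A × List Bool => z.1.2.2 :=
    Computable.snd.comp (Computable.snd.comp Computable.fst)
  have hidx : Computable fun z : A × List Bool => z.1.2.2.idxOf z.2 + 1 :=
    Computable.succ.comp (computable_idxOf Computable.snd hL)
  have hcond : Computable₂ fun (z : A) (b : List Bool) =>
      bif decide (z.2.2.idxOf b + 1 ≤ z.2.2.length) then z.2.2 else z.2.2 ++ [b] :=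
    Computable.cond (computable_decide_le_length hidx hL) hL
      (Computable.list_concat.comp hL Computable.snd)
  have hval : Computable fun z : A => e z.1.1 z.2.1 :=
    he.comp (Computable.fst.comp Computable.fst) (Computable.fst.comp Computable.snd)
  have hacc : Computable fun z : A => z.2.2 := Computable.snd.comp Computable.snd
  have hstep : Computable fun z : A => (e z.1.1 z.2.1).elim z.2.2 fun b =>
      bif decide (z.2.2.idxOf b + 1 ≤ z.2.2.length) then z.2.2 else z.2.2 ++ [b] :=
    (Computable.option_casesOn hval hacc hcond).of_eq fun z => by cases e z.1.1 z.2.1 <;> rfl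
  have hzero : Computable fun _ : σ × ℕ => ([] : List (List Bool)) := Computable.const []
  refine (Computable.nat_rec (f := fun z : σ × ℕ => z.2) Computable.snd hzero
    hstep.to₂).of_eq ?_
  rintro ⟨P, s⟩
  induction s with
  | zero => rfl
  | succ s ih =>
    simp only [enumList] at ih ⊢
    rw [ih]

/-- The element of an enumeration with a given index, ignoring repetitions. -/
def enumNth (e : ℕ → Option (List Bool)) (i : ℕ) : Part (List Bool) :=
  Nat.rfindOpt fun s => (enumList e s)[i]?

theorem mem_enumNth {e : ℕ → Option (List Bool)} {i : ℕ} {b : List Bool} :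
    b ∈ enumNth e i ↔ ∃ s, (enumList e s)[i]? = some b :=
  Nat.rfindOpt_mono fun {_ _ _} h hb => by
    obtain ⟨t, ht⟩ := enumList_prefix e h
    obtain ⟨hi, -⟩ := List.getElem?_eq_some_iff.1 hb
    rw [← ht, Option.mem_def, List.getElem?_append_left hi]
    exact hb

theorem partrec_enumNth {σ : Type} [Primcodable σ] {e : σ → ℕ → Option (List Bool)}
    (he : Computable₂ e) : Partrec₂ fun P i => enumNth (e P) i :=
  Partrec.rfindOpt (Computable.list_getElem?.comp
    ((computable_enumList he).comp (Computable.fst.comp Computable.fst) Computable.snd)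
    (Computable.snd.comp Computable.fst))

theorem exists_index {e : ℕ → Option (List Bool)} {s m : ℕ} {b : List Bool}
    (hb : b ∈ enumList e s) (hm : (enumList e s).length ≤ 2 ^ m) :
    ∃ l : List Bool, l.length ≤ m ∧ b ∈ enumNth e (bitsVal l) := by
  obtain ⟨i, hi, h⟩ := List.getElem_of_mem hb
  refine ⟨i.bits, ?_, mem_enumNth.2 ⟨s, ?_⟩⟩
  · rw [Nat.size_eq_bits_len, Nat.size_le]
    omega
  · rw [bitsVal_bits, List.getElem?_eq_getElem hi, h]

theorem Partrec.exists_stages {α β : Type} [Primcodable α] [Primcodable β] {g : α →. β}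
    (hg : Partrec g) :
    ∃ h : ℕ × α → Option β, Computable h ∧ ∀ a b, b ∈ g a ↔ ∃ k, h (k, a) = some b := by
  obtain ⟨c, hc⟩ := Nat.Partrec.Code.exists_code.1 hg
  refine ⟨fun z => (c.evaln z.1 (Encodable.encode z.2)).bind Encodable.decode, ?_, ?_⟩
  · refine Computable.option_bind ?_ (Computable.decode.comp Computable.snd)
    exact Nat.Partrec.Code.primrec_evaln.to_comp.comp
      ((Computable.fst.pair (Computable.const c)).pair (Computable.encode.comp Computable.snd))
  · intro a b
    have h : ∀ m, m ∈ c.eval (Encodable.encode a) ↔ ∃ b ∈ g a, Encodable.encode b = m := by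
      intro m
      simp [hc]
    constructor
    · intro hb
      obtain ⟨k, hk⟩ := Nat.Partrec.Code.evaln_complete.1 ((h _).2 ⟨b, hb, rfl⟩)
      exact ⟨k, by simp [Option.mem_def.1 hk]⟩
    · rintro ⟨k, hk⟩
      obtain ⟨m, hm, hd⟩ := Option.bind_eq_some_iff.1 hk
      obtain ⟨d, hmem, rfl⟩ := (h m).1 (Nat.Partrec.Code.evaln_complete.2 ⟨k, hm⟩)
      simp only [Encodable.encodek, Option.some.injEq] at hd
      exact hd ▸ hmem

/-- Enumeration of the rows of length `P.1` meeting, in a column of length `P.2.1`, the level set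
of value `P.2.2` of a partial function with stage approximation `h`. -/
def rowEnum (h : ℕ × List Bool × List Bool → Option (List Bool)) (P : ℕ × ℕ × List Bool)
    (s : ℕ) : Option (List Bool) :=
  (Encodable.decode s : Option (ℕ × List Bool × List Bool)).bind fun z =>
    bif decide (h z = some P.2.2) &&
      (decide (z.2.1.length = P.1) && decide (z.2.2.length = P.2.1))
    then some z.2.1 else none

theorem rowEnum_eq_some {h : ℕ × List Bool × List Bool → Option (List Bool)}
    {kx ky s : ℕ} {w p : List Bool} (H : rowEnum h (kx, ky, w) s = some p) :
    ∃ k q, h (k, p, q) = some w ∧ p.length = kx ∧ q.length = ky := by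
  obtain ⟨⟨k, p', q⟩, -, hz⟩ := Option.bind_eq_some_iff.1 H
  rw [Bool.cond_eq_ite] at hz
  split_ifs at hz with hc
  simp only [Bool.and_eq_true, decide_eq_true_eq, Option.some.injEq] at hc hz
  subst hz
  exact ⟨k, q, hc⟩

theorem exists_rowEnum_eq_some {h : ℕ × List Bool × List Bool → Option (List Bool)}
    {k : ℕ} {w p q : List Bool} (H : h (k, p, q) = some w) :
    ∃ s, rowEnum h (p.length, q.length, w) s = some p :=
  ⟨Encodable.encode (k, p, q), by simp [rowEnum, H]⟩

theorem computable_rowEnum {h : ℕ × List Bool × List Bool → Option (List Bool)}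
    (hh : Computable h) : Computable₂ (rowEnum h) := by
  let A := ((ℕ × ℕ × List Bool) × ℕ) × ℕ × List Bool × List Bool
  have hz : Computable fun a : A => a.2 := Computable.snd
  have hP : Computable fun a : A => a.1.1 := Computable.fst.comp Computable.fst
  have hrow : Computable fun a : A => a.2.2.1 := Computable.fst.comp (Computable.snd.comp hz)
  have hcol : Computable fun a : A => a.2.2.2 := Computable.snd.comp (Computable.snd.comp hz)
  have hx : Computable fun a : A => a.1.1.1 := Computable.fst.comp hP
  have hy : Computable fun a : A => a.1.1.2.1 := Computable.fst.comp (Computable.snd.comp hP)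
  have hw : Computable fun a : A => some a.1.1.2.2 :=
    Computable.option_some.comp (Computable.snd.comp (Computable.snd.comp hP))
  have h₁ : Computable fun a : A => decide (h a.2 = some a.1.1.2.2) :=
    computable_decide_eq (hh.comp hz) hw
  have h₂ : Computable fun a : A => decide (a.2.2.1.length = a.1.1.1) :=
    computable_decide_eq (Computable.list_length.comp hrow) hx
  have h₃ : Computable fun a : A => decide (a.2.2.2.length = a.1.1.2.1) :=
    computable_decide_eq (Computable.list_length.comp hcol) hy
  exact Computable.option_bind (Computable.decode.comp Computable.snd)
    (Computable.cond (Primrec.and.to_comp.comp h₁ (Primrec.and.to_comp.comp h₂ h₃))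
      (Computable.option_some.comp hrow) (Computable.const none)).to₂

/-- Enumeration of the values whose level sets, restricted to rows of length `P.1` and columns of
length `P.2.1`, have at least `2 ^ P.2.2.1` rows and at least `2 ^ P.2.2.2` columns. -/
def valueEnum (h h' : ℕ × List Bool × List Bool → Option (List Bool)) (P : ℕ × ℕ × ℕ × ℕ)
    (s : ℕ) : Option (List Bool) :=
  (Encodable.decode s : Option (ℕ × List Bool)).bind fun z =>
    bif decide (2 ^ P.2.2.1 ≤ (enumList (rowEnum h (P.1, P.2.1, z.2)) z.1).length) &&
      decide (2 ^ P.2.2.2 ≤ (enumList (rowEnum h' (P.2.1, P.1, z.2)) z.1).length)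
    then some z.2 else none

theorem valueEnum_eq_some {h h' : ℕ × List Bool × List Bool → Option (List Bool)}
    {kx ky a b s : ℕ} {w : List Bool} (H : valueEnum h h' (kx, ky, a, b) s = some w) :
    ∃ k, 2 ^ a ≤ (enumList (rowEnum h (kx, ky, w)) k).length ∧
      2 ^ b ≤ (enumList (rowEnum h' (ky, kx, w)) k).length := by
  obtain ⟨⟨k, w'⟩, -, hz⟩ := Option.bind_eq_some_iff.1 H
  rw [Bool.cond_eq_ite] at hz
  split_ifs at hz with hc
  simp only [Bool.and_eq_true, decide_eq_true_eq, Option.some.injEq] at hc hz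
  subst hz
  exact ⟨k, hc⟩

theorem exists_valueEnum_eq_some {h h' : ℕ × List Bool × List Bool → Option (List Bool)}
    {kx ky a b k : ℕ} {w : List Bool}
    (ha : 2 ^ a ≤ (enumList (rowEnum h (kx, ky, w)) k).length)
    (hb : 2 ^ b ≤ (enumList (rowEnum h' (ky, kx, w)) k).length) :
    ∃ s, valueEnum h h' (kx, ky, a, b) s = some w :=
  ⟨Encodable.encode (k, w), by simp [valueEnum, ha, hb]⟩

theorem computable_valueEnum {h h' : ℕ × List Bool × List Bool → Option (List Bool)}
    (hh : Computable h) (hh' : Computable h') : Computable₂ (valueEnum h h') := by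
  have hpow : Computable₂ ((· ^ ·) : ℕ → ℕ → ℕ) := (Primrec₂.unpaired'.1 Nat.Primrec.pow).to_comp
  let A := ((ℕ × ℕ × ℕ × ℕ) × ℕ) × ℕ × List Bool
  have hk : Computable fun a : A => a.2.1 := Computable.fst.comp Computable.snd
  have hw : Computable fun a : A => a.2.2 := Computable.snd.comp Computable.snd
  have hP : Computable fun a : A => a.1.1 := Computable.fst.comp Computable.fst
  have hx : Computable fun a : A => a.1.1.1 := Computable.fst.comp hP
  have hy : Computable fun a : A => a.1.1.2.1 := Computable.fst.comp (Computable.snd.comp hP)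
  have ha : Computable fun a : A => 2 ^ a.1.1.2.2.1 :=
    hpow.comp (Computable.const 2)
      (Computable.fst.comp (Computable.snd.comp (Computable.snd.comp hP)))
  have hb : Computable fun a : A => 2 ^ a.1.1.2.2.2 :=
    hpow.comp (Computable.const 2)
      (Computable.snd.comp (Computable.snd.comp (Computable.snd.comp hP)))
  have hA : Computable fun a : A => enumList (rowEnum h (a.1.1.1, a.1.1.2.1, a.2.2)) a.2.1 :=
    (computable_enumList (computable_rowEnum hh)).comp (hx.pair (hy.pair hw)) hk
  have hB : Computable fun a : A => enumList (rowEnum h' (a.1.1.2.1, a.1.1.1, a.2.2)) a.2.1 :=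
    (computable_enumList (computable_rowEnum hh')).comp (hy.pair (hx.pair hw)) hk
  exact Computable.option_bind (Computable.decode.comp Computable.snd)
    (Computable.cond (Primrec.and.to_comp.comp (computable_decide_le_length ha hA)
      (computable_decide_le_length hb hB))
      (Computable.option_some.comp hw) (Computable.const none)).to₂

/-! ### Counting -/

theorem exists_finset_length_eq (k : ℕ) :
    ∃ S : Finset (List Bool), S.card ≤ 2 ^ k ∧ ∀ p : List Bool, p.length = k → p ∈ S := by
  refine ⟨(Finset.univ : Finset (Fin k → Bool)).image List.ofFn, ?_, ?_⟩
  · exact Finset.card_image_le.trans (by simp)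
  · rintro p rfl
    exact Finset.mem_image.2 ⟨p.get, Finset.mem_univ _, List.ofFn_get p⟩

theorem length_enumList_rowEnum_le (h : ℕ × List Bool × List Bool → Option (List Bool))
    (kx ky : ℕ) (w : List Bool) (s : ℕ) :
    (enumList (rowEnum h (kx, ky, w)) s).length ≤ 2 ^ kx := by
  obtain ⟨S, hS, hmem⟩ := exists_finset_length_eq kx
  rw [← List.toFinset_card_of_nodup (nodup_enumList _ s)]
  refine (Finset.card_le_card fun p hp => ?_).trans hS
  obtain ⟨i, -, hi⟩ := mem_enumList.1 (List.mem_toFinset.1 hp)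
  obtain ⟨-, -, -, hp, -⟩ := rowEnum_eq_some hi
  exact hmem p hp

/-- Level sets of a partial function with the rectangle property are disjoint rectangles, so few
of them are large. -/
theorem length_enumList_valueEnum_mul_le {T : List Bool × List Bool →. List Bool}
    (hT : ∀ p q p' q' w, w ∈ T (p, q) → w ∈ T (p', q') → w ∈ T (p, q'))
    {h h' : ℕ × List Bool × List Bool → Option (List Bool)}
    (hh : ∀ k p q w, h (k, p, q) = some w → w ∈ T (p, q))
    (hh' : ∀ k p q w, h' (k, q, p) = some w → w ∈ T (p, q)) (kx ky a b s : ℕ) :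
    (enumList (valueEnum h h' (kx, ky, a, b)) s).length * 2 ^ (a + b) ≤ 2 ^ (kx + ky) := by
  classical
  obtain ⟨S, hS, hSmem⟩ := exists_finset_length_eq kx
  obtain ⟨S', hS', hSmem'⟩ := exists_finset_length_eq ky
  set L := enumList (valueEnum h h' (kx, ky, a, b)) s
  let R : List Bool → Finset (List Bool × List Bool) := fun w =>
    (S ×ˢ S').filter fun z => w ∈ T z
  have hR : ∀ w ∈ L.toFinset, 2 ^ (a + b) ≤ (R w).card := by
    intro w hw
    obtain ⟨i, -, hi⟩ := mem_enumList.1 (List.mem_toFinset.1 hw)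
    obtain ⟨k, ha, hb⟩ := valueEnum_eq_some hi
    rw [← List.toFinset_card_of_nodup (nodup_enumList _ k)] at ha hb
    rw [pow_add]
    refine (Nat.mul_le_mul ha hb).trans ?_
    rw [← Finset.card_product]
    refine Finset.card_le_card ?_
    rintro ⟨p, q⟩ hpq
    rw [Finset.mem_product, List.mem_toFinset, List.mem_toFinset] at hpq
    obtain ⟨i, -, hi⟩ := mem_enumList.1 hpq.1
    obtain ⟨j, -, hj⟩ := mem_enumList.1 hpq.2
    obtain ⟨k₁, q₁, h₁, hp, -⟩ := rowEnum_eq_some hi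
    obtain ⟨k₂, p₂, h₂, hq, -⟩ := rowEnum_eq_some hj
    exact Finset.mem_filter.2 ⟨Finset.mem_product.2 ⟨hSmem _ hp, hSmem' _ hq⟩,
      hT _ _ _ _ _ (hh _ _ _ _ h₁) (hh' _ _ _ _ h₂)⟩
  have hdisj : (L.toFinset : Set (List Bool)).PairwiseDisjoint R := by
    intro w _ w' _ hne
    refine Finset.disjoint_left.2 fun z hz hz' => hne ?_
    exact Part.mem_unique (Finset.mem_filter.1 hz).2 (Finset.mem_filter.1 hz').2
  calc L.length * 2 ^ (a + b) = L.toFinset.card * 2 ^ (a + b) := by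
        rw [List.toFinset_card_of_nodup (nodup_enumList _ s)]
    _ ≤ ∑ w ∈ L.toFinset, (R w).card := by
        simpa using Finset.card_nsmul_le_sum _ _ _ hR
    _ = (L.toFinset.biUnion R).card := (Finset.card_biUnion hdisj).symm
    _ ≤ (S ×ˢ S').card := Finset.card_le_card
        (Finset.biUnion_subset.2 fun _ _ => Finset.filter_subset _ _)
    _ ≤ 2 ^ (kx + ky) := by
        rw [Finset.card_product, pow_add]
        gcongr

/-- The binary logarithm of the number of enumerated rows. -/
theorem exists_log_length_enumList (h : ℕ × List Bool × List Bool → Option (List Bool))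
    {kx ky : ℕ} {w p : List Bool} {s : ℕ} (hp : p ∈ enumList (rowEnum h (kx, ky, w)) s) :
    ∃ a k, 2 ^ a ≤ (enumList (rowEnum h (kx, ky, w)) k).length ∧
      ∀ i, (enumList (rowEnum h (kx, ky, w)) i).length ≤ 2 ^ (a + 1) := by
  obtain ⟨k, hk⟩ : ∃ k, ∀ i, (enumList (rowEnum h (kx, ky, w)) i).length ≤
      (enumList (rowEnum h (kx, ky, w)) k).length := by
    have hbdd : BddAbove (Set.range fun i => (enumList (rowEnum h (kx, ky, w)) i).length) :=
      ⟨2 ^ kx, by rintro _ ⟨i, rfl⟩; exact length_enumList_rowEnum_le h kx ky w i⟩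
    obtain ⟨k, hk⟩ := Nat.sSup_mem (Set.range_nonempty _) hbdd
    exact ⟨k, fun i => (le_csSup hbdd ⟨i, rfl⟩).trans hk.ge⟩
  have hpos := (List.length_pos_of_mem hp).trans_le (hk s)
  exact ⟨_, k, Nat.pow_log_le_self 2 hpos.ne',
    fun i => (hk i).trans (Nat.lt_pow_succ_log_self one_lt_two _).le⟩

/-! ### The main inequality -/

theorem computable_ePair_prodMap {α : Type} [Primcodable α] {f : α → List Bool}
    (hf : Computable f) : Computable fun a : List Bool × α => ePair a.1 (f a.2) :=
  computable_ePair Computable.fst (hf.comp Computable.snd)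

theorem injective_ePair_prodMap {α : Type} {f : α → List Bool} (hf : Function.Injective f) :
    Function.Injective fun a : List Bool × α => ePair a.1 (f a.2) := by
  rintro ⟨x, a⟩ ⟨y, b⟩ h
  obtain ⟨rfl, h⟩ := ePair_inj h
  exact congrArg _ (hf h)

section Main

variable {U : Machine}

/-- A value with large level set is determined by its index among all such values. -/
theorem IsUniversal.exists_KC_value_le (hU : IsUniversal U)
    {h h' : ℕ × List Bool × List Bool → Option (List Bool)}
    (hh : Computable h) (hh' : Computable h') :
    ∃ c, ∀ kx ky a b m s w, w ∈ enumList (valueEnum h h' (kx, ky, a, b)) s →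
      (enumList (valueEnum h h' (kx, ky, a, b)) s).length ≤ 2 ^ m →
      KC U w [] ≤ m + 2 * (kx.size + ky.size + a.size + b.size) + c := by
  let A := List Bool × List Bool × List Bool × List Bool × List Bool
  have hv₁ : Computable fun z : A => bitsVal z.1 := computable_bitsVal.comp Computable.fst
  have hs₁ : Computable fun z : A => z.2 := Computable.snd
  have hv₂ : Computable fun z : A => bitsVal z.2.1 :=
    computable_bitsVal.comp (Computable.fst.comp hs₁)
  have hs₂ : Computable fun z : A => z.2.2 := Computable.snd.comp hs₁
  have hv₃ : Computable fun z : A => bitsVal z.2.2.1 :=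
    computable_bitsVal.comp (Computable.fst.comp hs₂)
  have hs₃ : Computable fun z : A => z.2.2.2 := Computable.snd.comp hs₂
  have hv₄ : Computable fun z : A => bitsVal z.2.2.2.1 :=
    computable_bitsVal.comp (Computable.fst.comp hs₃)
  have hv₅ : Computable fun z : A => bitsVal z.2.2.2.2 :=
    computable_bitsVal.comp (Computable.snd.comp hs₃)
  have hg : Partrec fun z : A => enumNth (valueEnum h h' (bitsVal z.1, bitsVal z.2.1,
      bitsVal z.2.2.1, bitsVal z.2.2.2.1)) (bitsVal z.2.2.2.2) :=
    (partrec_enumNth (computable_valueEnum hh hh')).comp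
      (hv₁.pair (hv₂.pair (hv₃.pair hv₄))) hv₅
  obtain ⟨c, hc⟩ := hU.exists_KC_le
    (computable_ePair_prodMap (computable_ePair_prodMap (computable_ePair_prodMap
      (computable_ePair_prodMap (Computable.id (α := List Bool))))))
    (injective_ePair_prodMap (injective_ePair_prodMap (injective_ePair_prodMap
      (injective_ePair_prodMap Function.injective_id)))) hg
  refine ⟨c + 8, fun kx ky a b m s w hw hm => ?_⟩
  obtain ⟨l, hl, hwl⟩ := exists_index hw hm
  have := hc (kx.bits, ky.bits, a.bits, b.bits, l) w (by simpa only [bitsVal_bits] using hwl)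
  simp only [ePair_length, Nat.size_eq_bits_len, id] at this
  omega

/-- A string with a program among few enumerated rows is determined by the index of that row. -/
theorem IsUniversal.exists_KC_pair_le (hU : IsUniversal U)
    {h : ℕ × List Bool × List Bool → Option (List Bool)} (hh : Computable h) :
    ∃ c, ∀ kx ky m s w p x, p ∈ enumList (rowEnum h (kx, ky, w)) s →
      (enumList (rowEnum h (kx, ky, w)) s).length ≤ 2 ^ m → x ∈ U p [] →
      KC U (ePair x w) [] ≤ KC U w [] + m + 2 * (kx.size + ky.size + m.size) + c := by
  let A := List Bool × List Bool × List Bool × List Bool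
  have hv₁ : Computable fun z : A => bitsVal z.1 := computable_bitsVal.comp Computable.fst
  have hs₁ : Computable fun z : A => z.2 := Computable.snd
  have hv₂ : Computable fun z : A => bitsVal z.2.1 :=
    computable_bitsVal.comp (Computable.fst.comp hs₁)
  have hs₂ : Computable fun z : A => z.2.2 := Computable.snd.comp hs₁
  have hv₃ : Computable fun z : A => bitsVal z.2.2.1 :=
    computable_bitsVal.comp (Computable.fst.comp hs₂)
  have hs₃ : Computable fun z : A => z.2.2.2 := Computable.snd.comp hs₂
  have hidx : Computable fun z : A => bitsVal (z.2.2.2.take (bitsVal z.2.2.1)) :=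
    computable_bitsVal.comp (Primrec.list_take.to_comp.comp hv₃ hs₃)
  have hdrop : Computable fun z : A => z.2.2.2.drop (bitsVal z.2.2.1) :=
    Primrec.list_drop.to_comp.comp hv₃ hs₃
  have hw : Partrec fun z : A => U (z.2.2.2.drop (bitsVal z.2.2.1)) [] :=
    hU.partrec_nil.comp hdrop
  have hrow : Partrec fun y : A × List Bool => enumNth (rowEnum h (bitsVal y.1.1,
      bitsVal y.1.2.1, y.2)) (bitsVal (y.1.2.2.2.take (bitsVal y.1.2.2.1))) :=
    (partrec_enumNth (computable_rowEnum hh)).comp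
      ((hv₁.comp Computable.fst).pair ((hv₂.comp Computable.fst).pair Computable.snd))
      (hidx.comp Computable.fst)
  have hx : Partrec fun y : (A × List Bool) × List Bool => U y.2 [] :=
    hU.partrec_nil.comp Computable.snd
  have hout : Computable fun y : ((A × List Bool) × List Bool) × List Bool =>
      ePair y.2 y.1.1.2 :=
    computable_ePair Computable.snd
      (Computable.snd.comp (Computable.fst.comp Computable.fst))
  have hg := hw.bind (hrow.bind (hx.map hout.to₂).to₂).to₂
  obtain ⟨c, hc⟩ := hU.exists_KC_le
    (computable_ePair_prodMap (computable_ePair_prodMap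
      (computable_ePair_prodMap (Computable.id (α := List Bool)))))
    (injective_ePair_prodMap (injective_ePair_prodMap
      (injective_ePair_prodMap Function.injective_id))) hg
  refine ⟨c + 6, fun kx ky m s w p x hp hm hx => ?_⟩
  obtain ⟨l, hl, hpl⟩ := exists_index hp hm
  obtain ⟨r, hr, hwr⟩ := hU.exists_program w
  have := hc (kx.bits, ky.bits, l.length.bits, l ++ r) (ePair x w) (by
    simp only [bitsVal_bits, List.take_left', List.drop_left']
    exact Part.mem_bind hwr (Part.mem_bind hpl (Part.mem_map (fun x => ePair x w) hx)))
  simp only [ePair_length, Nat.size_eq_bits_len, id, List.length_append] at this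
  have := Nat.size_le_size hl
  omega

theorem IsUniversal.exists_KC_le_length (hU : IsUniversal U) :
    ∃ c, ∀ x, KC U x [] ≤ x.length + c := by
  obtain ⟨c, hc⟩ := hU.exists_KC_le Computable.id Function.injective_id
    (Partrec.some (α := List Bool))
  exact ⟨c, fun x => hc x x (Part.mem_some x)⟩

/-- For a computable function with the rectangle property, conditioning on its value does not
increase mutual information, up to a logarithmic term. -/
theorem IsUniversal.exists_KC_pair_add_KC_pair_le (hU : IsUniversal U)
    {t : List Bool → List Bool → List Bool} (ht : Computable₂ t) (hrect : RectProperty t) :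
    ∃ c, ∀ x y, KC U (ePair x (t x y)) [] + KC U (ePair y (t x y)) [] ≤
      KC U x [] + KC U y [] + KC U (t x y) [] +
        c * ((KC U x [] + 1).size + (KC U y [] + 1).size) + c := by
  let T : List Bool × List Bool →. List Bool := fun z =>
    (U z.1 []).bind fun x => (U z.2 []).map fun y => t x y
  have hout : Computable fun y : ((List Bool × List Bool) × List Bool) × List Bool =>
      t y.1.2 y.2 :=
    ht.comp (Computable.snd.comp Computable.fst) Computable.snd
  have hy : Partrec fun y : (List Bool × List Bool) × List Bool => U y.1.2 [] :=
    hU.partrec_nil.comp (Computable.snd.comp Computable.fst)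
  have hTp : Partrec T := (hU.partrec_nil.comp Computable.fst).bind (hy.map hout.to₂).to₂
  have hT : ∀ p q w, w ∈ T (p, q) ↔ ∃ x ∈ U p [], ∃ y ∈ U q [], t x y = w := by
    intro p q w
    simp [T]
  have hTrect : ∀ p q p' q' w, w ∈ T (p, q) → w ∈ T (p', q') → w ∈ T (p, q') := by
    intro p q p' q' w h h'
    obtain ⟨x, hx, y, hy, rfl⟩ := (hT _ _ _).1 h
    obtain ⟨x', hx', y', hy', h'⟩ := (hT _ _ _).1 h'
    exact (hT _ _ _).2 ⟨x, hx, y', hy', (hrect x y x' y' h'.symm).1⟩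
  obtain ⟨h, hh, hmem⟩ := hTp.exists_stages
  let h' : ℕ × List Bool × List Bool → Option (List Bool) := fun z => h (z.1, z.2.2, z.2.1)
  have hh' : Computable h' := hh.comp (Computable.fst.pair
    ((Computable.snd.comp Computable.snd).pair (Computable.fst.comp Computable.snd)))
  obtain ⟨c₁, hc₁⟩ := hU.exists_KC_value_le hh hh'
  obtain ⟨c₂, hc₂⟩ := hU.exists_KC_pair_le hh
  obtain ⟨c₃, hc₃⟩ := hU.exists_KC_pair_le hh'
  refine ⟨c₁ + c₂ + c₃ + 12, fun x y => ?_⟩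
  obtain ⟨p, hp, hx⟩ := hU.exists_program x
  obtain ⟨q, hq, hy⟩ := hU.exists_program y
  obtain ⟨k, hk⟩ := (hmem (p, q) (t x y)).1 ((hT _ _ _).2 ⟨x, hx, y, hy, rfl⟩)
  obtain ⟨i, hi⟩ := exists_rowEnum_eq_some hk
  obtain ⟨j, hj⟩ := exists_rowEnum_eq_some (h := h') (k := k) (p := q) (q := p) hk
  have hi := mem_enumList.2 ⟨i, i.lt_succ_self, hi⟩
  have hj := mem_enumList.2 ⟨j, j.lt_succ_self, hj⟩
  rw [hp, hq] at hi hj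
  obtain ⟨a, ka, ha, ha'⟩ := exists_log_length_enumList h hi
  obtain ⟨b, kb, hb, hb'⟩ := exists_log_length_enumList h' hj
  have hax := (Nat.pow_le_pow_iff_right one_lt_two).1
    (ha.trans (length_enumList_rowEnum_le h _ _ _ _))
  have hby := (Nat.pow_le_pow_iff_right one_lt_two).1
    (hb.trans (length_enumList_rowEnum_le h' _ _ _ _))
  obtain ⟨s, hs⟩ := exists_valueEnum_eq_some
    (ha.trans (enumList_prefix _ (le_max_left ka kb)).length_le)
    (hb.trans (enumList_prefix _ (le_max_right ka kb)).length_le)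
  have hs := mem_enumList.2 ⟨s, s.lt_succ_self, hs⟩
  have hcount := length_enumList_valueEnum_mul_le hTrect
    (fun k p q w hw => (hmem (p, q) w).2 ⟨k, hw⟩)
    (h' := h') (fun k p q w hw => (hmem (p, q) w).2 ⟨k, hw⟩)
    (KC U x []) (KC U y []) a b (s + 1)
  have hvalue := hc₁ _ _ _ _ (KC U x [] + KC U y [] - (a + b)) _ _ hs (by
    rw [← Nat.sub_add_cancel (add_le_add hax hby), pow_add 2 _ (a + b)] at hcount
    exact Nat.le_of_mul_le_mul_right hcount (Nat.two_pow_pos _))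
  have hpx := hc₂ _ _ (a + 1) _ _ _ _ hi (ha' _) hx
  have hpy := hc₃ _ _ (b + 1) _ _ _ _ hj (hb' _) hy
  have h₁ := Nat.size_le_size hax
  have h₂ := Nat.size_le_size hby
  have h₃ := Nat.size_le_size (Nat.succ_le_succ hax)
  have h₄ := Nat.size_le_size (Nat.succ_le_succ hby)
  have h₅ := Nat.size_le_size (KC U x []).le_succ
  have h₆ := Nat.size_le_size (KC U y []).le_succ
  simp only [Nat.succ_eq_add_one] at h₃ h₄ h₅ h₆
  have h₇ : 12 * ((KC U x [] + 1).size + (KC U y [] + 1).size) ≤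
      (c₁ + c₂ + c₃ + 12) * ((KC U x [] + 1).size + (KC U y [] + 1).size) :=
    Nat.mul_le_mul_right _ (by omega)
  omega

theorem Nat.size_add_le {n : ℕ} (hn : 1 ≤ n) (c : ℕ) : (n + c).size ≤ n.size + c := by
  rw [Nat.size_le]
  induction c with
  | zero => exact Nat.lt_size_self n
  | succ c ih =>
    rw [← add_assoc, ← add_assoc, pow_succ]
    omega

theorem Nat.size_le_logb_add_one (n : ℕ) : (n.size : ℝ) ≤ Real.logb 2 n + 1 := by
  have h : n.size ≤ Nat.log 2 n + 1 :=
    Nat.size_le.2 (Nat.lt_pow_succ_log_self one_lt_two n)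
  have h' := Real.natLog_le_logb n 2
  have : (n.size : ℝ) ≤ Nat.log 2 n + 1 := by exact_mod_cast h
  push_cast at h'
  linarith

end Main

/-- For every computable function `t` with the rectangle property there is a constant `d`
such that `I(x : y : t(x,y)) ≥ -d·log₂ n - d` for all `n`-bit strings `x, y` (`n ≥ 2`). -/
theorem stmt0 (U : Machine) (hU : IsUniversal U)
    (t : List Bool → List Bool → List Bool) (ht : Computable₂ t) (hrect : RectProperty t) :
    ∃ d : ℝ, ∀ n : ℕ, 2 ≤ n → ∀ x y : List Bool, x.length = n → y.length = n →
      TI U x y (t x y) [] ≥ -(d * Real.logb 2 n) - d := by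
  obtain ⟨c₁, hc₁⟩ := hU.exists_KC_pair_add_KC_pair_le ht hrect
  obtain ⟨c₂, hc₂⟩ := hU.exists_KC_pair_le_triple
  obtain ⟨c₃, hc₃⟩ := hU.exists_KC_le_length
  refine ⟨(c₁ * (2 * (c₃ + 2)) + c₁ + c₂ : ℕ), fun n hn x y hx hy => ?_⟩
  have h₁ := hc₁ x y
  have h₂ := hc₂ x y (t x y)
  have hsize : ∀ z : List Bool, z.length = n → (KC U z [] + 1).size ≤ n.size + (c₃ + 1) := by
    intro z hz
    refine (Nat.size_le_size ?_).trans (Nat.size_add_le (by omega) (c₃ + 1))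
    have := hc₃ z
    omega
  have h₃ : c₁ * ((KC U x [] + 1).size + (KC U y [] + 1).size) ≤
      c₁ * (2 * (n.size + (c₃ + 1))) :=
    Nat.mul_le_mul_left _ (by have := hsize x hx; have := hsize y hy; omega)
  have hlog := Nat.size_le_logb_add_one n
  have hlog₀ : 0 ≤ Real.logb 2 n :=
    Real.logb_nonneg one_lt_two (by exact_mod_cast (by omega : 1 ≤ n))
  have h₁ := h₁.trans (Nat.add_le_add_right (Nat.add_le_add_left h₃ _) _)
  have h₄ : (KC U (ePair x (t x y)) [] : ℝ) + KC U (ePair y (t x y)) [] ≤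
      KC U x [] + KC U y [] + KC U (t x y) [] + c₁ * (2 * (n.size + (c₃ + 1))) + c₁ := by
    exact_mod_cast h₁
  have h₅ : (KC U (ePair x y) [] : ℝ) ≤ KC U (ePair x (ePair y (t x y))) [] + c₂ := by
    exact_mod_cast h₂
  have h₆ : (c₁ : ℝ) * n.size ≤ c₁ * (Real.logb 2 n + 1) := by gcongr
  have h₇ : 0 ≤ ((c₁ * (2 * (c₃ + 1)) + c₁ + c₂ : ℕ) : ℝ) * Real.logb 2 n := by positivity
  unfold TI
  push_cast at h₇ ⊢
  linarith
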